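/- Let θ = 3, X = {x, y}, and let ρ : I → Sym(X) be given by ρ_1 = ρ_2 = id and ρ_3 the transposition exchanging x and y. Let C^x = [[2, −1, 0], [−1, 2, −1], [0, −2, 2]] and C^y = [[2, −1, 0], [−2, 2, −1], [0, −2, 2]]. Let Δ^x_+ = {(1,0,0), (1,1,0), (1,1,1), (2,3,4), (1,2,2), (1,2,3), (1,2,4), (1,3,4), (1,1,2), (0,1,0), (0,1,2), (0,1,1), (0,0,1)} and Δ^y_+ = {(1,0,0), (1,2,0), (1,1,0), (1,1,2), (1,3,2), (2,3,2), (1,2,2), (1,1,1), (1,2,1), (0,1,0), (0,1,2), (0,1,1), (0,0,1)}, and set Δ^z := Δ^z_+ ∪ (−Δ^z_+) for z ∈ {x, y}. Then (X, ρ) is a connected basic datum, (C^x, C^y) is a Cartan datum for (X, ρ), and ((C^z)_{z∈X}, (Δ^z)_{z∈X}) is a generalized root system for (X, ρ). -/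

import Mathlib

open Function

/-- The reflection `s_i` determined by the `i`-th row of a generalized Cartan matrix `C`,
acting on `ℤ^θ`; on the standard basis it is `s_i(α_j) = α_j - C i j • α_i`. -/
def cartanRefl {θ : ℕ} (C : Matrix (Fin θ) (Fin θ) ℤ) (i : Fin θ) :
    (Fin θ → ℤ) → (Fin θ → ℤ) :=
  fun v => v - (∑ j, C i j * v j) • Pi.single i 1

/-- A generalized root system `(C, Δ)` over a connected basic datum `(X, ρ)`. -/
structure GRS (θ : ℕ) (X : Type*) where
  nonempty : Nonempty X
  /-- The basic datum: a family of involutive permutations of `X`. -/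
  ρ : Fin θ → Equiv.Perm X
  ρ_invol : ∀ i, ρ i * ρ i = 1
  /-- Connectedness of the basic datum. -/
  connected : ∀ x y : X, Relation.ReflTransGen (fun a b => ∃ i, ρ i a = b) x y
  /-- The Cartan datum: a bundle of generalized Cartan matrices. -/
  C : X → Matrix (Fin θ) (Fin θ) ℤ
  C_diag : ∀ x i, C x i i = 2
  C_offdiag : ∀ x i j, i ≠ j → C x i j ≤ 0
  C_zero_iff : ∀ x i j, i ≠ j → (C x i j = 0 ↔ C x j i = 0)
  C_compat : ∀ x i j, C (ρ i x) i j = C x i j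
  /-- The bundle of root sets. -/
  Δ : X → Set (Fin θ → ℤ)
  /-- Axiom (1): `Δ^x = Δ^x_+ ∪ Δ^x_-`, where `Δ^x_± = ±(Δ^x ∩ ℕ₀^θ)`. -/
  root_pos_neg : ∀ x, Δ x = (Δ x ∩ {v | ∀ k, 0 ≤ v k}) ∪ ((fun v => -v) '' (Δ x ∩ {v | ∀ k, 0 ≤ v k}))
  /-- Axiom (2): `Δ^x ∩ ℤα_i = {α_i, -α_i}`. -/
  root_simple : ∀ x i, Δ x ∩ {v | ∃ n : ℤ, v = n • (Pi.single i 1 : Fin θ → ℤ)}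
      = {Pi.single i 1, -Pi.single i 1}
  /-- Axiom (3): `s_i^x(Δ^x) = Δ^{ρ_i(x)}`. -/
  root_refl : ∀ x i, cartanRefl (C x) i '' Δ x = Δ (ρ i x)
  /-- Axiom (4): `(ρ_i ρ_j)^{m^x_{ij}}(x) = x` where `m^x_{ij} = |Δ^x ∩ (ℕ₀α_i + ℕ₀α_j)|`. -/
  root_coxeter : ∀ x i j, i ≠ j →
    (Δ x ∩ {v | ∃ p q : ℕ, v = p • (Pi.single i 1 : Fin θ → ℤ) + q • Pi.single j 1}).Finite →
    ((ρ i * ρ j) ^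
      (Δ x ∩ {v | ∃ p q : ℕ, v = p • (Pi.single i 1 : Fin θ → ℤ) + q • Pi.single j 1}).ncard) x = x

namespace GRS

variable {θ : ℕ} {X : Type*} (R : GRS θ X)

/-- The set of positive roots `Δ^x_+` at `x`. -/
def pos (x : X) : Set (Fin θ → ℤ) := {v ∈ R.Δ x | ∀ k, 0 ≤ v k}

/-- Membership in the Weyl groupoid `W(R)`: `Weyl R x g y` says that the triple `(x, g, y)`
belongs to the subgroupoid of `X × GL(ℤ^θ) × X` generated by the `ς_i^x = (x, s_i^x, ρ_i(x))`. -/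
inductive Weyl : X → ((Fin θ → ℤ) → (Fin θ → ℤ)) → X → Prop
  | nil (x : X) : Weyl x _root_.id x
  | cons (x : X) (i : Fin θ) {g : (Fin θ → ℤ) → (Fin θ → ℤ)} {y : X} :
      Weyl (R.ρ i x) g y → Weyl x (cartanRefl (R.C x) i ∘ g) y

/-- Endpoint of the word `ς_{i_1}^x ς_{i_2} ⋯ ς_{i_t}` (with implicit superscripts). -/
def wordEnd : X → List (Fin θ) → X
  | x, [] => x
  | x, i :: l => wordEnd (R.ρ i x) l

/-- The element of `GL(ℤ^θ)` given by the word `ς_{i_1}^x ς_{i_2} ⋯ ς_{i_t}`: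
the composition `s_{i_1}^x ∘ s_{i_2}^{ρ_{i_1}(x)} ∘ ⋯`. -/
def wordMap : X → List (Fin θ) → ((Fin θ → ℤ) → (Fin θ → ℤ))
  | _, [] => _root_.id
  | x, i :: l => cartanRefl (R.C x) i ∘ wordMap (R.ρ i x) l

/-- The length `ℓ(w)` of the element `w = (x, g, y)` of the Weyl groupoid: the least number of
generators needed to express it. -/
noncomputable def len (x : X) (g : (Fin θ → ℤ) → (Fin θ → ℤ)) (y : X) : ℕ :=
  sInf {t | ∃ l : List (Fin θ), l.length = t ∧ R.wordEnd x l = y ∧ R.wordMap x l = g}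

/-- The set of real roots `(Δ^{re})^x` at `x`. -/
def realRoots (x : X) : Set (Fin θ → ℤ) :=
  {v | ∃ (i : Fin θ) (g : (Fin θ → ℤ) → (Fin θ → ℤ)) (y : X), R.Weyl x g y ∧ v = g (Pi.single i 1)}

/-- The generalized root system is finite: its Weyl groupoid is a finite set. -/
def FiniteWeyl : Prop :=
  {p : X × ((Fin θ → ℤ) → (Fin θ → ℤ)) × X | R.Weyl p.1 p.2.1 p.2.2}.Finite

end GRS

/-- The basic datum of the example: `ρ_1 = ρ_2 = id`, `ρ_3` exchanges the two points
(`false` plays the role of `x`, `true` of `y`). -/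
def exRho : Fin 3 → Equiv.Perm Bool := ![1, 1, Equiv.swap false true]

/-- The Cartan datum of the example. -/
def exC : Bool → Matrix (Fin 3) (Fin 3) ℤ := fun b =>
  if b then !![2, -1, 0; -2, 2, -1; 0, -2, 2] else !![2, -1, 0; -1, 2, -1; 0, -2, 2]

/-- The positive roots `Δ^x_+` at the point `x = false`. -/
def exPosX : Set (Fin 3 → ℤ) :=
  {![1,0,0], ![1,1,0], ![1,1,1], ![2,3,4], ![1,2,2], ![1,2,3], ![1,2,4], ![1,3,4], ![1,1,2],
   ![0,1,0], ![0,1,2], ![0,1,1], ![0,0,1]}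

/-- The positive roots `Δ^y_+` at the point `y = true`. -/
def exPosY : Set (Fin 3 → ℤ) :=
  {![1,0,0], ![1,2,0], ![1,1,0], ![1,1,2], ![1,3,2], ![2,3,2], ![1,2,2], ![1,1,1], ![1,2,1],
   ![0,1,0], ![0,1,2], ![0,1,1], ![0,0,1]}

/-- The bundle of root sets `Δ^z = Δ^z_+ ∪ (-Δ^z_+)` of the example. -/
def exDelta : Bool → Set (Fin 3 → ℤ) := fun b =>
  (if b then exPosY else exPosX) ∪ ((fun v => -v) '' (if b then exPosY else exPosX))

/-- Membership in `ℤα_i`, coordinatewise. -/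
theorem exists_zsmul_single_iff {ι : Type*} [DecidableEq ι] (i : ι) (v : ι → ℤ) :
    (∃ n : ℤ, v = n • (Pi.single i 1 : ι → ℤ)) ↔ ∀ k, k ≠ i → v k = 0 := by
  constructor
  · rintro ⟨n, rfl⟩ k hk
    simp [hk]
  · intro h
    refine ⟨v i, funext fun k => ?_⟩
    by_cases hk : k = i
    · subst hk; simp
    · simp [hk, h k hk]

/-- Membership in `ℕ₀α_i + ℕ₀α_j`, coordinatewise. -/
theorem exists_nsmul_single_add_iff {ι : Type*} [DecidableEq ι] {i j : ι} (hij : i ≠ j)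
    (v : ι → ℤ) :
    (∃ p q : ℕ, v = p • (Pi.single i 1 : ι → ℤ) + q • Pi.single j 1) ↔
      (∀ k, 0 ≤ v k) ∧ ∀ k, k ≠ i → k ≠ j → v k = 0 := by
  constructor
  · rintro ⟨p, q, rfl⟩
    refine ⟨fun k => ?_, fun k hi hj => by simp [hi, hj]⟩
    by_cases hi : k = i <;> by_cases hj : k = j <;>
      simp [Pi.single_apply, hi, hj] <;> split_ifs <;> omega
  · rintro ⟨h0, h⟩
    refine ⟨(v i).toNat, (v j).toNat, funext fun k => ?_⟩
    by_cases hi : k = i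
    · subst hi; simp [hij, h0 k]
    · by_cases hj : k = j
      · subst hj; simp [hi, h0 k]
      · simp [hi, hj, h k hi hj]

/-- The positive roots of the example as a finset. -/
def exPosFinset (b : Bool) : Finset (Fin 3 → ℤ) :=
  if b then
    {![1,0,0], ![1,2,0], ![1,1,0], ![1,1,2], ![1,3,2], ![2,3,2], ![1,2,2], ![1,1,1], ![1,2,1],
     ![0,1,0], ![0,1,2], ![0,1,1], ![0,0,1]}
  else
    {![1,0,0], ![1,1,0], ![1,1,1], ![2,3,4], ![1,2,2], ![1,2,3], ![1,2,4], ![1,3,4], ![1,1,2],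
     ![0,1,0], ![0,1,2], ![0,1,1], ![0,0,1]}

/-- The roots of the example as a finset. -/
def exRootFinset (b : Bool) : Finset (Fin 3 → ℤ) :=
  exPosFinset b ∪ (exPosFinset b).image (fun v => -v)

theorem exDelta_eq_coe (b : Bool) : exDelta b = (exRootFinset b : Set (Fin 3 → ℤ)) := by
  cases b <;>
    simp only [exDelta, exRootFinset, exPosFinset, exPosX, exPosY, Finset.coe_union,
      Finset.coe_image, Finset.coe_insert, Finset.coe_singleton, Bool.false_eq_true, if_true,
      if_false]

theorem exRootFinset_eq_pos_union_neg (b : Bool) :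
    exRootFinset b = (exRootFinset b).filter (fun v => ∀ k, 0 ≤ v k) ∪
      ((exRootFinset b).filter (fun v => ∀ k, 0 ≤ v k)).image (fun v => -v) := by
  revert b; decide +kernel

theorem exRootFinset_filter_simple (b : Bool) (i : Fin 3) :
    (exRootFinset b).filter (fun v => ∀ k, k ≠ i → v k = 0) =
      {Pi.single i 1, -Pi.single i 1} := by
  revert b i; decide +kernel

theorem image_cartanRefl_exRootFinset (b : Bool) (i : Fin 3) :
    (exRootFinset b).image (cartanRefl (exC b) i) = exRootFinset (exRho i b) := by
  revert b i; decide +kernel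

theorem exRho_mul_pow_card (b : Bool) (i j : Fin 3) (hij : i ≠ j) :
    ((exRho i * exRho j) ^ ((exRootFinset b).filter
      (fun v => (∀ k, 0 ≤ v k) ∧ ∀ k, k ≠ i → k ≠ j → v k = 0)).card) b = b := by
  revert b i j; decide +kernel

/-- The generalized root system of the example. -/
def exGRS : GRS 3 Bool where
  nonempty := ⟨false⟩
  ρ := exRho
  ρ_invol := by decide
  connected a b := by
    by_cases h : a = b
    · exact h ▸ .refl
    · exact .single ⟨2, by revert a b; decide⟩
  C := exC
  C_diag := by decide
  C_offdiag b i j := by cases b <;> fin_cases i <;> fin_cases j <;> decide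
  C_zero_iff b i j := by cases b <;> fin_cases i <;> fin_cases j <;> decide
  C_compat b i j := by cases b <;> fin_cases i <;> fin_cases j <;> decide
  Δ := exDelta
  root_pos_neg b := by
    rw [exDelta_eq_coe]
    ext v
    simpa only [Set.mem_union, Set.mem_image, Set.mem_inter_iff, Set.mem_ofPred_eq,
      Finset.mem_coe, Finset.mem_union, Finset.mem_image, Finset.mem_filter] using
      Finset.ext_iff.mp (exRootFinset_eq_pos_union_neg b) v
  root_simple b i := by
    rw [exDelta_eq_coe]
    ext v
    simpa only [exists_zsmul_single_iff, Set.mem_inter_iff, Set.mem_ofPred_eq, Finset.mem_coe,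
      Set.mem_insert_iff, Set.mem_singleton_iff, Finset.mem_filter, Finset.mem_insert,
      Finset.mem_singleton] using Finset.ext_iff.mp (exRootFinset_filter_simple b i) v
  root_refl b i := by
    rw [exDelta_eq_coe, exDelta_eq_coe, ← Finset.coe_image, image_cartanRefl_exRootFinset]
  root_coxeter b i j hij _ := by
    have h : exDelta b ∩
        {v | ∃ p q : ℕ, v = p • (Pi.single i 1 : Fin 3 → ℤ) + q • Pi.single j 1} =
        ((exRootFinset b).filter
          (fun v => (∀ k, 0 ≤ v k) ∧ ∀ k, k ≠ i → k ≠ j → v k = 0) : Finset _) := by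
      ext v
      simp only [exDelta_eq_coe, exists_nsmul_single_add_iff hij, Set.mem_inter_iff,
        Set.mem_ofPred_eq, Finset.coe_filter, Finset.mem_coe]
    rw [h, Set.ncard_coe_finset]
    exact exRho_mul_pow_card b i j hij

/-- The data `θ = 3`, `X = {x, y}`, `ρ_1 = ρ_2 = id`, `ρ_3 = (x y)`, the two
Cartan matrices `C^x`, `C^y` and the root sets `Δ^x = Δ^x_+ ∪ (-Δ^x_+)`,
`Δ^y = Δ^y_+ ∪ (-Δ^y_+)` listed above form a connected basic datum, a Cartan datum and a
generalized root system. -/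
theorem stmt13 :
    ∃ R : GRS 3 Bool, R.ρ = exRho ∧ R.C = exC ∧ R.Δ = exDelta := by
  exact ⟨exGRS, rfl, rfl, rfl⟩
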